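/- For every integer d > 2, A_d = 1 + Σ_{ℓ=1}^{d−2} Σ_{k=1}^{d−2} Σ_{i=k}^{d−2} Σ_{j=2}^{d−2} O(d−ℓ−1, d−1, i, d−j) · O(d−ℓ, i−1, k−1, j). -/

import Mathlib

open scoped BigOperators

/-- The largest `k` such that `C(k,t) ≤ a` (used in the greedy binomial expansion). -/
def maxBinomIdx (a t : ℕ) : ℕ :=
  ((Finset.range (a + t + 1)).filter fun k => Nat.choose k t ≤ a).sup id

/-- `a^{⟨t⟩}`, computed via the (unique, hence greedy) binomial expansion of `a` in base `t`:
if `a = C(k_t,t) + C(k_{t-1},t-1) + ⋯ + C(k_j,j)` with `k_t > ⋯ > k_j ≥ j ≥ 1`, then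
`a^{⟨t⟩} = C(k_t+1,t+1) + ⋯ + C(k_j+1,j+1)`; by convention `0^{⟨t⟩} = 0`. -/
def macaulay : ℕ → ℕ → ℕ
  | _, 0 => 0
  | a, t + 1 =>
    if a = 0 then 0
    else
      Nat.choose (maxBinomIdx a (t + 1) + 1) (t + 2) +
        macaulay (a - Nat.choose (maxBinomIdx a (t + 1)) (t + 1)) t

/-- A finite O-sequence: `h 0 = 1`, `h` vanishes after its first zero, `h` is eventually zero,
and `h (t+1) ≤ (h t)^{⟨t⟩}` for every `t ≥ 1`. -/
def IsFiniteOSeq (h : ℕ → ℕ) : Prop :=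
  h 0 = 1 ∧ (∀ t, h t = 0 → h (t + 1) = 0) ∧ (∃ N, ∀ t, N ≤ t → h t = 0) ∧
    ∀ t, 1 ≤ t → h (t + 1) ≤ macaulay (h t) t

/-- The multiplicity (length) `d = Σ_t h t` of a finite O-sequence. -/
noncomputable def mult (h : ℕ → ℕ) : ℕ := ∑ᶠ t, h t

/-- The socle degree `s = max {t : h t ≠ 0}` of a finite O-sequence. -/
noncomputable def socleDeg (h : ℕ → ℕ) : ℕ := sSup {t | h t ≠ 0}

/-- `countO p n k d = O(p,n,k,d)`: for `p ≥ 1`, `n ≥ 0`, `k ≥ 0`, `d ≥ 1`, the number of finite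
O-sequences `h` of multiplicity `d` and socle degree at most `n` with `h i = C(p-1+i,i)` for
`0 ≤ i ≤ k` and `h i < C(p-1+i,i)` for `i > k`; moreover `O(0,n,0,1) = 1` for `n ≥ 0`,
`O(0,n,k,d) = 0` for `k > 0` or `d > 1`, and `O(p,n,k,d) = 0` if `p < 0`, `n < 0`, `k < 0`
or `d ≤ 0`. -/
noncomputable def countO (p n k d : ℤ) : ℕ :=
  if 1 ≤ p ∧ 0 ≤ n ∧ 0 ≤ k ∧ 1 ≤ d then
    {h : ℕ → ℕ | IsFiniteOSeq h ∧ mult h = d.toNat ∧ socleDeg h ≤ n.toNat ∧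
        (∀ i : ℕ, (i : ℤ) ≤ k → h i = Nat.choose (p.toNat - 1 + i) i) ∧
        (∀ i : ℕ, k < (i : ℤ) → h i < Nat.choose (p.toNat - 1 + i) i)}.ncard
  else if p = 0 ∧ 0 ≤ n ∧ k = 0 ∧ d = 1 then 1
  else 0

/-- `O_d`: the number of finite O-sequences of multiplicity `d`. -/
noncomputable def countOd (d : ℕ) : ℕ :=
  {h : ℕ → ℕ | IsFiniteOSeq h ∧ mult h = d}.ncard

/-- `A_d`: the number of finite O-sequences of multiplicity `d` whose value at the socle degree
is at least `2`. -/
noncomputable def countAd (d : ℕ) : ℕ :=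
  {h : ℕ → ℕ | IsFiniteOSeq h ∧ mult h = d ∧ 2 ≤ h (socleDeg h)}.ncard

/-! ### Macaulay's operator and multichoose numbers -/

lemma multichoose_pos {q : ℕ} (hq : 0 < q) (t : ℕ) : 0 < Nat.multichoose q t := by
  rw [Nat.multichoose_eq]
  exact Nat.choose_pos (by omega)

lemma multichoose_succ_add (q t : ℕ) :
    Nat.multichoose (q + 1) (t + 1) = Nat.multichoose q (t + 1) + Nat.multichoose (q + 1) t :=
  Nat.multichoose_succ_succ q t

lemma multichoose_mono_left {q r : ℕ} (h : q ≤ r) (t : ℕ) :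
    Nat.multichoose q t ≤ Nat.multichoose r t := by
  rw [Nat.multichoose_eq, Nat.multichoose_eq]
  exact Nat.choose_le_choose t (by omega)

lemma macaulay_zero_left (t : ℕ) : macaulay 0 t = 0 := by
  cases t <;> simp [macaulay]

lemma maxBinomIdx_eq {a t m : ℕ} (ht : 0 < t) (h₁ : m.choose t ≤ a)
    (h₂ : a < (m + 1).choose t) : maxBinomIdx a t = m := by
  have key : a < (a + t).choose t := by
    have h : (a + 1).choose a ≤ (a + t).choose a := Nat.choose_le_choose a (by omega)
    rw [Nat.choose_succ_self_right, Nat.choose_symm_add] at h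
    omega
  refine le_antisymm (Finset.sup_le fun k hk => ?_) ?_
  · simp only [Finset.mem_filter] at hk
    by_contra hlt
    have := Nat.choose_le_choose t (show m + 1 ≤ k by simp at hlt; omega)
    omega
  · refine Finset.le_sup (f := id) (b := m) ?_
    simp only [Finset.mem_filter, Finset.mem_range]
    refine ⟨?_, h₁⟩
    by_contra hlt
    have := Nat.choose_le_choose t (show a + t ≤ m by omega)
    omega

lemma macaulay_of_mem_Ico {a q t : ℕ} (h₁ : Nat.multichoose q (t + 1) ≤ a)
    (h₂ : a < Nat.multichoose (q + 1) (t + 1)) :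
    macaulay a (t + 1) =
      Nat.multichoose q (t + 2) + macaulay (a - Nat.multichoose q (t + 1)) t := by
  rcases Nat.eq_zero_or_pos q with rfl | hq
  · obtain rfl : a = 0 := by simpa using h₂
    simp [macaulay_zero_left]
  · have ha : a ≠ 0 := by have := multichoose_pos hq (t + 1); omega
    have hm : maxBinomIdx a (t + 1) = q + t := by
      apply maxBinomIdx_eq (Nat.succ_pos t)
      · rw [Nat.multichoose_eq] at h₁
        exact h₁
      · rw [Nat.multichoose_eq] at h₂
        convert h₂ using 2
        omega
    rw [macaulay, if_neg ha, hm, Nat.multichoose_eq, Nat.multichoose_eq]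
    rfl

lemma macaulay_multichoose (q t : ℕ) :
    macaulay (Nat.multichoose q (t + 1)) (t + 1) = Nat.multichoose q (t + 2) := by
  rw [macaulay_of_mem_Ico le_rfl]
  · simp [macaulay_zero_left]
  · rw [multichoose_succ_add]
    have := multichoose_pos q.add_one_pos t
    omega

lemma exists_multichoose_le_lt {a q t : ℕ} (h : a < Nat.multichoose q (t + 1)) :
    ∃ r < q, Nat.multichoose r (t + 1) ≤ a ∧ a < Nat.multichoose (r + 1) (t + 1) := by
  induction q with
  | zero => simp at h
  | succ q ih =>
    by_cases hq : a < Nat.multichoose q (t + 1)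
    · obtain ⟨r, hr, h'⟩ := ih hq
      exact ⟨r, by omega, h'⟩
    · exact ⟨q, by omega, by omega, h⟩

lemma macaulay_lt_multichoose {a q t : ℕ} (hq : 0 < q) (h : a < Nat.multichoose q t) :
    macaulay a t < Nat.multichoose q (t + 1) := by
  induction t generalizing a q with
  | zero => simpa [macaulay] using hq
  | succ t ih =>
    obtain ⟨r, hr, h₁, h₂⟩ := exists_multichoose_le_lt h
    have hrec := multichoose_succ_add r t
    have hlt := ih r.add_one_pos (show a - Nat.multichoose r (t + 1) < _ by omega)
    have hmono := multichoose_mono_left (show r + 1 ≤ q by omega) (t + 2)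
    rw [macaulay_of_mem_Ico h₁ h₂]
    have hrec' := multichoose_succ_add r (t + 1)
    simp only [add_assoc, Nat.reduceAdd] at *
    omega

lemma macaulay_pos {a t : ℕ} (ha : 0 < a) (ht : 0 < t) : 0 < macaulay a t := by
  obtain ⟨t, rfl⟩ : ∃ s, t = s + 1 := ⟨t - 1, by omega⟩
  have hlarge : a < Nat.multichoose (a + 1) (t + 1) := by
    rw [Nat.multichoose_eq]
    have h : (a + 1).choose a ≤ (a + 1 + (t + 1) - 1).choose a :=
      Nat.choose_le_choose a (by omega)
    rw [show a + 1 + (t + 1) - 1 = a + (t + 1) by omega] at h ⊢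
    rw [Nat.choose_succ_self_right, Nat.choose_symm_add] at h
    omega
  obtain ⟨r, -, h₁, h₂⟩ := exists_multichoose_le_lt hlarge
  have hr : 0 < r := by
    rcases Nat.eq_zero_or_pos r with rfl | hr
    · simp at h₂
      omega
    · exact hr
  rw [macaulay_of_mem_Ico h₁ h₂]
  have := multichoose_pos hr (t + 2)
  omega

/-! ### Multiplicity, socle degree and finiteness -/

lemma mult_eq_sum_range {h : ℕ → ℕ} {N : ℕ} (hN : ∀ t, N ≤ t → h t = 0) :
    mult h = ∑ t ∈ Finset.range N, h t := by
  refine finsum_eq_sum_of_support_subset h fun t ht => ?_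
  simp only [Finset.coe_range, Set.mem_Iio]
  by_contra hlt
  exact ht (hN t (by omega))

lemma socleDeg_le_iff {h : ℕ → ℕ} {N n : ℕ} (hN : ∀ t, N ≤ t → h t = 0) :
    socleDeg h ≤ n ↔ ∀ t, n < t → h t = 0 := by
  have hbdd : BddAbove {t | h t ≠ 0} :=
    ⟨N, fun t ht => by by_contra hlt; exact ht (hN t (by omega))⟩
  constructor
  · intro hs t ht
    by_contra hne
    have : t ≤ socleDeg h := le_csSup hbdd hne
    omega
  · intro hz
    exact csSup_le' fun t ht => by by_contra hlt; exact ht (hz t (by omega))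

namespace IsFiniteOSeq

variable {h : ℕ → ℕ}

lemma of_le_macaulay (h₀ : h 0 = 1) (hN : ∃ N, ∀ t, N ≤ t → h t = 0)
    (hm : ∀ t, h (t + 2) ≤ macaulay (h (t + 1)) (t + 1)) : IsFiniteOSeq h := by
  refine ⟨h₀, ?_, hN, ?_⟩
  · rintro (_ | t) ht
    · omega
    · have := hm t
      rw [ht, macaulay_zero_left] at this
      exact Nat.le_zero.mp this
  · rintro (_ | t) ht
    · omega
    · exact hm t

lemma eq_zero_of_le (hh : IsFiniteOSeq h) {s t : ℕ} (hst : s ≤ t) (hs : h s = 0) : h t = 0 := by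
  induction t, hst using Nat.le_induction with
  | base => exact hs
  | succ t _ ih => exact hh.2.1 t ih

lemma sum_range_le_mult (hh : IsFiniteOSeq h) (n : ℕ) :
    ∑ t ∈ Finset.range n, h t ≤ mult h := by
  obtain ⟨N, hN⟩ := hh.2.2.1
  rw [mult_eq_sum_range (N := max N n) fun t ht => hN t (le_trans (le_max_left _ _) ht)]
  exact Finset.sum_le_sum_of_subset (Finset.range_mono (le_max_right _ _))

lemma lt_mult (hh : IsFiniteOSeq h) {t : ℕ} (ht : h t ≠ 0) : t < mult h := by
  refine lt_of_lt_of_le (Nat.lt_succ_self t) (le_trans ?_ (hh.sum_range_le_mult (t + 1)))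
  calc t + 1 = ∑ _s ∈ Finset.range (t + 1), 1 := by simp
    _ ≤ _ := Finset.sum_le_sum fun s hs => Nat.one_le_iff_ne_zero.mpr fun h0 =>
      ht (hh.eq_zero_of_le (by simp at hs; omega) h0)

lemma eq_zero_of_mult_le (hh : IsFiniteOSeq h) {t : ℕ} (ht : mult h ≤ t) : h t = 0 := by
  by_contra hne
  have := hh.lt_mult hne
  omega

lemma le_mult (hh : IsFiniteOSeq h) (t : ℕ) : h t ≤ mult h :=
  le_trans (Finset.single_le_sum (f := h) (fun _ _ => Nat.zero_le _)
    (Finset.self_mem_range_succ t)) (hh.sum_range_le_mult (t + 1))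

lemma one_add_le_mult (hh : IsFiniteOSeq h) : 1 + h 1 ≤ mult h := by
  have := hh.sum_range_le_mult 2
  rwa [Finset.sum_range_succ, Finset.sum_range_one, hh.1] at this

lemma mult_eq_one (hh : IsFiniteOSeq h) (h₁ : h 1 = 0) : mult h = 1 := by
  rw [mult_eq_sum_range fun t ht => hh.eq_zero_of_le ht h₁, Finset.sum_range_one, hh.1]

lemma socleDeg_le (hh : IsFiniteOSeq h) {n : ℕ} : socleDeg h ≤ n ↔ ∀ t, n < t → h t = 0 :=
  socleDeg_le_iff fun _ => hh.eq_zero_of_mult_le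

lemma eq_zero_of_socleDeg_lt (hh : IsFiniteOSeq h) {t : ℕ} (ht : socleDeg h < t) : h t = 0 :=
  hh.socleDeg_le.mp le_rfl t ht

lemma ne_zero_of_le_socleDeg (hh : IsFiniteOSeq h) {t : ℕ} (ht : t ≤ socleDeg h) : h t ≠ 0 := by
  intro h0
  rcases t with _ | t
  · have := hh.1
    omega
  · have : socleDeg h ≤ t := hh.socleDeg_le.mpr fun s hs => hh.eq_zero_of_le (by omega) h0
    omega

lemma socleDeg_eq (hh : IsFiniteOSeq h) {n : ℕ} (hn : h n ≠ 0) (hn' : h (n + 1) = 0) :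
    socleDeg h = n := by
  refine le_antisymm (hh.socleDeg_le.mpr fun t ht => hh.eq_zero_of_le (by omega) hn') ?_
  by_contra hlt
  exact hn (hh.eq_zero_of_socleDeg_lt (by omega))

lemma mult_eq_sum_socleDeg (hh : IsFiniteOSeq h) :
    mult h = ∑ t ∈ Finset.range (socleDeg h + 1), h t :=
  mult_eq_sum_range fun _ ht => hh.eq_zero_of_socleDeg_lt (by omega)

lemma lt_multichoose_succ (hh : IsFiniteOSeq h) {q t : ℕ} (hq : 0 < q)
    (ht : h (t + 1) < Nat.multichoose q (t + 1)) : h (t + 2) < Nat.multichoose q (t + 2) :=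
  lt_of_le_of_lt (hh.2.2.2 (t + 1) (by omega)) (macaulay_lt_multichoose hq ht)

lemma lt_multichoose_of_le (hh : IsFiniteOSeq h) {q s t : ℕ} (hq : 0 < q) (hst : s ≤ t)
    (hs : h s < Nat.multichoose q s) : h t < Nat.multichoose q t := by
  induction t, hst using Nat.le_induction with
  | base => exact hs
  | succ t _ ih =>
    rcases t with _ | t
    · rw [hh.1] at ih
      simp at ih
    · exact hh.lt_multichoose_succ hq ih

lemma le_multichoose (hh : IsFiniteOSeq h) {q : ℕ} (hq : 0 < q) (h₁ : h 1 ≤ q) (t : ℕ) :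
    h t ≤ Nat.multichoose q t := by
  induction t with
  | zero => simp [hh.1]
  | succ t ih =>
    rcases t with _ | t
    · simpa using h₁
    · rcases ih.lt_or_eq with hlt | heq
      · exact (hh.lt_multichoose_succ hq hlt).le
      · have := hh.2.2.2 (t + 1) (by omega)
        rwa [heq, macaulay_multichoose] at this

end IsFiniteOSeq

/-- The finite O-sequences of multiplicity `d`. -/
def oSeqs (d : ℕ) : Set (ℕ → ℕ) := {h | IsFiniteOSeq h ∧ mult h = d}

lemma finite_oSeqs (d : ℕ) : (oSeqs d).Finite := by
  refine Set.Finite.of_finite_image (f := fun h (i : Fin d) => h i) ?_ ?_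
  · refine (Set.finite_Iic (fun _ : Fin d => d)).subset ?_
    rintro _ ⟨h, ⟨hh, rfl⟩, rfl⟩
    exact fun i => hh.le_mult i
  · rintro h ⟨hh, hd⟩ g ⟨hg, hd'⟩ heq
    funext t
    by_cases ht : t < d
    · exact congrFun heq ⟨t, ht⟩
    · rw [hh.eq_zero_of_mult_le (by omega), hg.eq_zero_of_mult_le (by omega)]

/-! ### Splitting off the part that does not involve a given variable -/

/-- The part of `h` that fits into `q` variables. -/
def lowerPart (q : ℕ) (h : ℕ → ℕ) (t : ℕ) : ℕ := min (h t) (Nat.multichoose q t)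

/-- The excess of `h` over the Hilbert function of a polynomial ring in `q` variables, shifted
down by one degree. -/
def upperPart (q : ℕ) (h : ℕ → ℕ) (t : ℕ) : ℕ := h (t + 1) - Nat.multichoose q (t + 1)

/-- The sum of `f` and of `g` shifted up by one degree. -/
def addShift (f g : ℕ → ℕ) : ℕ → ℕ
  | 0 => f 0
  | t + 1 => f (t + 1) + g t

/-- `h` reaches the Hilbert function of a polynomial ring in `q` variables exactly in the
degrees up to `i`. -/
def ReachesUpTo (q i : ℕ) (h : ℕ → ℕ) : Prop := ∀ t, t ≤ i ↔ Nat.multichoose q t ≤ h t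

/-- `h` coincides with the Hilbert function of a polynomial ring in `q` variables up to degree
`i` and is strictly below it in larger degrees. -/
def AgreesUpTo (q i : ℕ) (h : ℕ → ℕ) : Prop :=
  (∀ t, t ≤ i → h t = Nat.multichoose q t) ∧ ∀ t, i < t → h t < Nat.multichoose q t

/-- The last degree in which `h` reaches the Hilbert function of a polynomial ring in `q`
variables. -/
noncomputable def lastReached (q : ℕ) (h : ℕ → ℕ) : ℕ :=
  sInf {t | h (t + 1) < Nat.multichoose q (t + 1)}

lemma IsFiniteOSeq.reachesUpTo_iff {h : ℕ → ℕ} (hh : IsFiniteOSeq h) {q i : ℕ} (hq : 0 < q) :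
    ReachesUpTo q i h ↔ lastReached q h = i := by
  have hne : {t | h (t + 1) < Nat.multichoose q (t + 1)}.Nonempty := by
    obtain ⟨N, hN⟩ := hh.2.2.1
    refine ⟨N, ?_⟩
    rw [Set.mem_ofPred_eq, hN _ (Nat.le_succ N)]
    exact multichoose_pos hq _
  constructor
  · intro hr
    refine le_antisymm (Nat.sInf_le ?_) (le_csInf hne fun t ht => ?_)
    · have := hr (i + 1)
      simp only [Set.mem_ofPred_eq]
      omega
    · have := hr (t + 1)
      simp only [Set.mem_ofPred_eq] at ht
      omega
  · rintro rfl t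
    constructor
    · intro ht
      rcases t with _ | t
      · simp [hh.1]
      · have := Nat.notMem_of_lt_sInf (show t < sInf _ from ht)
        simpa using this
    · intro ht
      by_contra hlt
      have := hh.lt_multichoose_of_le hq (show lastReached q h + 1 ≤ t by omega)
        (Nat.sInf_mem hne)
      omega

lemma AgreesUpTo.le {q i : ℕ} {h : ℕ → ℕ} (ha : AgreesUpTo q i h) (t : ℕ) :
    h t ≤ Nat.multichoose q t := by
  by_cases ht : t ≤ i
  · exact (ha.1 t ht).le
  · exact (ha.2 t (by omega)).le

section Split

variable {h : ℕ → ℕ} {q : ℕ}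

lemma lowerPart_add_upperPart (t : ℕ) :
    lowerPart q h (t + 1) + upperPart q h t = h (t + 1) := by
  simp only [lowerPart, upperPart]
  omega

lemma addShift_lowerPart_upperPart (hh : IsFiniteOSeq h) :
    addShift (lowerPart q h) (upperPart q h) = h := by
  funext t
  rcases t with _ | t
  · simp [addShift, lowerPart, hh.1]
  · exact lowerPart_add_upperPart t

lemma mult_addShift {f g : ℕ → ℕ} (hf : ∃ N, ∀ t, N ≤ t → f t = 0)
    (hg : ∃ N, ∀ t, N ≤ t → g t = 0) : mult (addShift f g) = mult f + mult g := by
  obtain ⟨N, hN⟩ := hf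
  obtain ⟨M, hM⟩ := hg
  rw [mult_eq_sum_range (h := f) (N := max N M + 1) fun t ht => hN t (by omega),
    mult_eq_sum_range (h := g) (N := max N M) fun t ht => hM t (by omega),
    mult_eq_sum_range (h := addShift f g) (N := max N M + 1),
    Finset.sum_range_succ', Finset.sum_range_succ']
  · simp only [addShift, Finset.sum_add_distrib]
    omega
  · rintro (_ | t) ht
    · omega
    · simp [addShift, hN (t + 1) (by omega), hM t (by omega)]

lemma isFiniteOSeq_lowerPart (hh : IsFiniteOSeq h) (hq : 0 < q) :
    IsFiniteOSeq (lowerPart q h) := by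
  refine .of_le_macaulay (by simp [lowerPart, hh.1]) ?_ fun t => ?_
  · obtain ⟨N, hN⟩ := hh.2.2.1
    exact ⟨N, fun t ht => by simp [lowerPart, hN t ht]⟩
  · by_cases hlt : h (t + 1) < Nat.multichoose q (t + 1)
    · rw [lowerPart, lowerPart, min_eq_left hlt.le,
        min_eq_left (hh.lt_multichoose_succ hq hlt).le]
      exact hh.2.2.2 (t + 1) (by omega)
    · rw [lowerPart, lowerPart, min_eq_right (not_lt.mp hlt), macaulay_multichoose]
      exact min_le_right _ _

lemma isFiniteOSeq_upperPart (hh : IsFiniteOSeq h) (hq : 0 < q) (h₁ : h 1 = q + 1) :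
    IsFiniteOSeq (upperPart q h) := by
  refine .of_le_macaulay (by simp [upperPart, h₁]) ?_ fun t => ?_
  · obtain ⟨N, hN⟩ := hh.2.2.1
    exact ⟨N, fun t ht => by simp [upperPart, hN (t + 1) (by omega)]⟩
  · by_cases hlt : h (t + 2) < Nat.multichoose q (t + 2)
    · have := hh.lt_multichoose_succ hq hlt
      rw [upperPart, Nat.sub_eq_zero_of_le this.le]
      exact Nat.zero_le _
    · have hle := hh.le_multichoose q.add_one_pos h₁.le (t + 2)
      have hle' := hh.le_multichoose q.add_one_pos h₁.le (t + 3)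
      have hrec := multichoose_succ_add q (t + 1)
      have hrec' := multichoose_succ_add q (t + 2)
      have hm := hh.2.2.2 (t + 2) (by omega)
      simp only [upperPart, add_assoc, Nat.reduceAdd] at *
      rcases hle.lt_or_eq with hlt' | heq
      · rw [macaulay_of_mem_Ico (not_lt.mp hlt) hlt'] at hm
        simp only [add_assoc, Nat.reduceAdd] at hm
        omega
      · rw [show h (t + 2) - Nat.multichoose q (t + 2) = Nat.multichoose (q + 1) (t + 1) by omega,
          macaulay_multichoose]
        omega

lemma mult_lowerPart_add_mult_upperPart (hh : IsFiniteOSeq h) (hq : 0 < q) (h₁ : h 1 = q + 1) :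
    mult (lowerPart q h) + mult (upperPart q h) = mult h := by
  rw [← mult_addShift (isFiniteOSeq_lowerPart hh hq).2.2.1
    (isFiniteOSeq_upperPart hh hq h₁).2.2.1, addShift_lowerPart_upperPart hh]

lemma ReachesUpTo.agreesUpTo_lowerPart {i : ℕ} (hr : ReachesUpTo q i h) :
    AgreesUpTo q i (lowerPart q h) := by
  refine ⟨fun t ht => min_eq_right ((hr t).mp ht), fun t ht => ?_⟩
  have := hr t
  simp only [lowerPart]
  omega

lemma ReachesUpTo.agreesUpTo_upperPart (hh : IsFiniteOSeq h) (h₁ : h 1 = q + 1) {k : ℕ}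
    (hr : ReachesUpTo (q + 1) (k + 1) h) : AgreesUpTo (q + 1) k (upperPart q h) := by
  refine ⟨fun t ht => ?_, fun t ht => ?_⟩ <;>
  · have hr' := hr (t + 1)
    have hle := hh.le_multichoose q.add_one_pos h₁.le (t + 1)
    have hrec := multichoose_succ_add q t
    have hpos := multichoose_pos q.add_one_pos t
    simp only [upperPart] at *
    omega

end Split

section AddShift

variable {f g : ℕ → ℕ} {q i k : ℕ}

lemma isFiniteOSeq_addShift (hf : IsFiniteOSeq f) (hg : IsFiniteOSeq g)
    (hfi : AgreesUpTo q i f) (hgk : AgreesUpTo (q + 1) k g) (hgi : ∀ t, i ≤ t → g t = 0) :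
    IsFiniteOSeq (addShift f g) := by
  refine .of_le_macaulay hf.1 ?_ fun t => ?_
  · obtain ⟨N, hN⟩ := hf.2.2.1
    refine ⟨max N i + 1, ?_⟩
    rintro (_ | t) ht
    · omega
    · simp [addShift, hN (t + 1) (by omega), hgi t (by omega)]
  · simp only [addShift]
    have hmf := hf.2.2.2 (t + 1) (by omega)
    by_cases hti : t + 1 ≤ i
    · have hfle := hfi.le (t + 2)
      have hrec := multichoose_succ_add q t
      have hrec' := multichoose_succ_add q (t + 1)
      have hgle := hgk.le (t + 1)
      rw [hfi.1 _ hti]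
      simp only [add_assoc, Nat.reduceAdd] at *
      rcases (hgk.le t).lt_or_eq with hlt | heq
      · rw [macaulay_of_mem_Ico (q := q) (by omega) (by omega), Nat.add_sub_cancel_left]
        rcases t with _ | t
        · rw [hg.1] at hlt
          simp at hlt
        · have := hg.2.2.2 (t + 1) (by omega)
          simp only [add_assoc, Nat.reduceAdd] at *
          omega
      · rw [heq, ← hrec, macaulay_multichoose]
        omega
    · rw [hgi t (by omega), hgi (t + 1) (by omega)]
      exact hmf

lemma addShift_reachesUpTo_lower (hfi : AgreesUpTo q i f) (hgi : ∀ t, i ≤ t → g t = 0) :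
    ReachesUpTo q i (addShift f g) := by
  rintro (_ | t)
  · simp [addShift, hfi.1 0 (Nat.zero_le _)]
  · simp only [addShift]
    by_cases ht : t + 1 ≤ i
    · have := hfi.1 _ ht
      omega
    · have := hfi.2 (t + 1) (by omega)
      have := hgi t (by omega)
      omega

lemma addShift_reachesUpTo_upper (hfi : AgreesUpTo q i f) (hgk : AgreesUpTo (q + 1) k g)
    (hki : k < i) : ReachesUpTo (q + 1) (k + 1) (addShift f g) := by
  rintro (_ | t)
  · simp [addShift, hfi.1 0 (Nat.zero_le _)]
  · simp only [addShift]
    have hrec := multichoose_succ_add q t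
    have hfle := hfi.le (t + 1)
    by_cases ht : t ≤ k
    · have := hfi.1 (t + 1) (by omega)
      have := hgk.1 t ht
      omega
    · have := hgk.2 t (by omega)
      omega

lemma lowerPart_addShift (hfi : AgreesUpTo q i f) (hgi : ∀ t, i ≤ t → g t = 0) :
    lowerPart q (addShift f g) = f := by
  funext t
  rcases t with _ | t
  · simp [lowerPart, addShift, hfi.1 0 (Nat.zero_le _)]
  · simp only [lowerPart, addShift]
    by_cases ht : t + 1 ≤ i
    · have := hfi.1 _ ht
      omega
    · have := hfi.2 (t + 1) (by omega)
      have := hgi t (by omega)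
      omega

lemma upperPart_addShift (hfi : AgreesUpTo q i f) (hgi : ∀ t, i ≤ t → g t = 0) :
    upperPart q (addShift f g) = g := by
  funext t
  simp only [upperPart, addShift]
  by_cases ht : t + 1 ≤ i
  · have := hfi.1 _ ht
    omega
  · have := hfi.2 (t + 1) (by omega)
    have := hgi t (by omega)
    omega

end AddShift

/-! ### Counting -/

lemma countO_eq_ncard (q n k d : ℕ) (hd : 0 < d) :
    countO ((q : ℤ) + 1) n k d =
      {f ∈ oSeqs d | (∀ t, n < t → f t = 0) ∧ AgreesUpTo (q + 1) k f}.ncard := by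
  rw [countO, if_pos (by omega)]
  congr 1
  ext f
  have hp : ((q : ℤ) + 1).toNat - 1 = q := by omega
  have hm : ∀ i, Nat.multichoose (q + 1) i = (q + i).choose i := fun i => by
    rw [Nat.multichoose_eq]
    congr 1
    omega
  simp only [Set.mem_ofPred_eq, oSeqs, AgreesUpTo, hp, hm, Int.toNat_natCast, Nat.cast_le,
    Nat.cast_lt]
  constructor
  · rintro ⟨hf, hd, hs, hk⟩
    exact ⟨⟨hf, hd⟩, hf.socleDeg_le.mp hs, hk⟩
  · rintro ⟨⟨hf, hd⟩, hs, hk⟩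
    exact ⟨hf, hd, hf.socleDeg_le.mpr hs, hk⟩

lemma ncard_split_eq_countO_mul_countO {d q k i j : ℕ} (hki : k < i) (hj : 0 < j)
    (hjd : j < d) :
    {h ∈ oSeqs d | h 1 = q + 2 ∧ ReachesUpTo (q + 2) (k + 1) h ∧ ReachesUpTo (q + 1) i h ∧
        mult (upperPart (q + 1) h) = j}.ncard =
      countO ((q : ℤ) + 1) ((d : ℤ) - 1) i ((d : ℤ) - j) *
        countO ((q : ℤ) + 2) ((i : ℤ) - 1) k j := by
  have e₁ : countO ((q : ℤ) + 1) ((d : ℤ) - 1) i ((d : ℤ) - j) =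
      {f ∈ oSeqs (d - j) | (∀ t, d - 1 < t → f t = 0) ∧ AgreesUpTo (q + 1) i f}.ncard := by
    rw [← countO_eq_ncard _ _ _ _ (by omega)]
    congr 1 <;> omega
  have e₂ : countO ((q : ℤ) + 2) ((i : ℤ) - 1) k j =
      {g ∈ oSeqs j | (∀ t, i - 1 < t → g t = 0) ∧ AgreesUpTo (q + 2) k g}.ncard := by
    rw [← countO_eq_ncard _ _ _ _ hj]
    congr 1
    omega
  rw [e₁, e₂, ← Set.ncard_prod]
  refine Set.BijOn.ncard_eq (f := fun h => (lowerPart (q + 1) h, upperPart (q + 1) h))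
    (Set.InvOn.bijOn (f' := fun x => addShift x.1 x.2) ⟨?_, ?_⟩ ?_ ?_)
  · rintro h ⟨⟨hh, -⟩, -⟩
    exact addShift_lowerPart_upperPart hh
  · rintro ⟨f, g⟩ ⟨⟨-, -, hfi⟩, ⟨-, hgi, -⟩⟩
    have hgi' : ∀ t, i ≤ t → g t = 0 := fun t ht => hgi t (by omega)
    exact Prod.ext (lowerPart_addShift hfi hgi') (upperPart_addShift hfi hgi')
  · rintro h ⟨⟨hh, hd⟩, h₁, hk, hi, hu⟩
    have hl := isFiniteOSeq_lowerPart hh q.add_one_pos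
    have hm := mult_lowerPart_add_mult_upperPart hh q.add_one_pos h₁
    refine ⟨⟨⟨hl, show mult (lowerPart (q + 1) h) = d - j by omega⟩, fun t ht => hl.eq_zero_of_mult_le (by omega),
      hi.agreesUpTo_lowerPart⟩, ⟨isFiniteOSeq_upperPart hh q.add_one_pos h₁, hu⟩,
      fun t ht => ?_, hk.agreesUpTo_upperPart hh h₁⟩
    have := hi (t + 1)
    simp only [upperPart]
    omega
  · rintro ⟨f, g⟩ ⟨⟨⟨hf, hfd⟩, -, hfi⟩, ⟨⟨hg, hgd⟩, hgi, hgk⟩⟩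
    have hgi' : ∀ t, i ≤ t → g t = 0 := fun t ht => hgi t (by omega)
    refine ⟨⟨isFiniteOSeq_addShift hf hg hfi hgk hgi', ?_⟩, ?_,
      addShift_reachesUpTo_upper hfi hgk hki, addShift_reachesUpTo_lower hfi hgi', ?_⟩
    · rw [mult_addShift hf.2.2.1 hg.2.2.1]
      change mult f + mult g = d
      change mult f = d - j at hfd
      change mult g = j at hgd
      omega
    · have := hfi.1 1 (by omega)
      have := hg.1
      simp only [Nat.multichoose_one_right, addShift, zero_add] at *
      omega
    · exact (congrArg mult (upperPart_addShift hfi hgi')).trans hgd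

lemma ncard_sep_add_ncard_sep_not {α : Type*} {s : Set α} (hs : s.Finite) (P : α → Prop) :
    {x ∈ s | P x}.ncard + {x ∈ s | ¬ P x}.ncard = s.ncard :=
  Set.ncard_inter_add_ncard_sdiff_eq_ncard s {x | P x} hs

lemma mult_update_one {f : ℕ → ℕ} (hf : ∃ N, ∀ t, N ≤ t → f t = 0) (a : ℕ) :
    mult (Function.update f 1 a) + f 1 = mult f + a := by
  obtain ⟨N, hN⟩ := hf
  rw [mult_eq_sum_range (h := f) (N := N + 2) fun t ht => hN t (by omega),
    mult_eq_sum_range (h := Function.update f 1 a) (N := N + 2) fun t ht => by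
      rw [Function.update_of_ne (by omega), hN t (by omega)],
    Finset.sum_range_succ', Finset.sum_range_succ', Finset.sum_range_succ',
    Finset.sum_range_succ']
  have : ∀ t, Function.update f 1 a (t + 1 + 1) = f (t + 1 + 1) := fun t =>
    Function.update_of_ne (by omega) _ _
  simp only [this, zero_add, Function.update_self, Function.update_of_ne zero_ne_one]
  omega

lemma IsFiniteOSeq.update_one {f : ℕ → ℕ} (hf : IsFiniteOSeq f) {a : ℕ}
    (ha : f 2 ≤ Nat.multichoose a 2) : IsFiniteOSeq (Function.update f 1 a) := by
  refine .of_le_macaulay ?_ ?_ fun t => ?_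
  · rw [Function.update_of_ne zero_ne_one, hf.1]
  · obtain ⟨N, hN⟩ := hf.2.2.1
    exact ⟨N + 2, fun t ht => by rw [Function.update_of_ne (by omega), hN t (by omega)]⟩
  · rw [Function.update_of_ne (by omega)]
    rcases t with _ | t
    · have := macaulay_multichoose a 0
      simp only [zero_add, Nat.multichoose_one_right] at this
      simpa [this] using ha
    · rw [Function.update_of_ne (by omega)]
      exact hf.2.2.2 (t + 2) (by omega)

lemma ncard_oSeqs_of_le_multichoose {d : ℕ} (hd : 2 ≤ d) :
    {h ∈ oSeqs (d + 1) | 2 ≤ h 1 ∧ h 2 ≤ Nat.multichoose (h 1 - 1) 2}.ncard =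
      (oSeqs d).ncard := by
  refine Set.BijOn.ncard_eq (f := fun h => Function.update h 1 (h 1 - 1))
    (Set.InvOn.bijOn (f' := fun g => Function.update g 1 (g 1 + 1)) ⟨?_, ?_⟩ ?_ ?_)
  · rintro h ⟨-, h₁, -⟩
    simp only [Function.update_self, Function.update_idem]
    rw [Nat.sub_add_cancel (by omega), Function.update_eq_self]
  · intro g _
    simp
  · rintro h ⟨⟨hh, hm⟩, h₁, h₂⟩
    have := mult_update_one hh.2.2.1 (h 1 - 1)
    exact ⟨hh.update_one h₂, show mult (Function.update h 1 (h 1 - 1)) = d by omega⟩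
  · rintro g ⟨hg, hm⟩
    have hpos : g 1 ≠ 0 := fun h0 => by
      have := hg.mult_eq_one h0
      omega
    have hle := hg.le_multichoose (Nat.pos_of_ne_zero hpos) le_rfl 2
    have := mult_update_one hg.2.2.1 (g 1 + 1)
    refine ⟨⟨hg.update_one (hle.trans (multichoose_mono_left (Nat.le_succ _) 2)),
      show mult (Function.update g 1 (g 1 + 1)) = d + 1 by omega⟩, ?_, ?_⟩
    · simp only [Function.update_self]
      omega
    · simpa using hle

lemma ncard_oSeqs_socle_eq_one {d : ℕ} (hd : 1 ≤ d) :
    {h ∈ oSeqs (d + 1) | h (socleDeg h) = 1}.ncard = (oSeqs d).ncard := by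
  have hsucc : ∀ h ∈ {h ∈ oSeqs (d + 1) | h (socleDeg h) = 1},
      ∃ s, socleDeg h = s + 1 := by
    rintro h ⟨⟨hh, hm⟩, h₁⟩
    refine ⟨socleDeg h - 1, ?_⟩
    by_contra hs
    have h0 := hh.mult_eq_sum_socleDeg
    rw [show socleDeg h = 0 by omega, Finset.sum_range_one, hh.1] at h0
    omega
  have hdrop : ∀ h ∈ {h ∈ oSeqs (d + 1) | h (socleDeg h) = 1}, ∀ s, socleDeg h = s + 1 →
      Function.update h (s + 1) 0 ∈ oSeqs d ∧
        socleDeg (Function.update h (s + 1) 0) = s := by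
    rintro h ⟨⟨hh, hm⟩, h₁⟩ s hs
    have hz : ∀ t, s + 1 ≤ t → Function.update h (s + 1) 0 t = 0 := fun t ht => by
      rcases ht.eq_or_lt with rfl | hlt
      · simp
      · rw [Function.update_of_ne (by omega), hh.eq_zero_of_socleDeg_lt (by omega)]
    have hO : IsFiniteOSeq (Function.update h (s + 1) 0) := by
      refine .of_le_macaulay ?_ ⟨s + 1, hz⟩ fun t => ?_
      · rw [Function.update_of_ne (by omega), hh.1]
      · by_cases ht : s + 1 ≤ t + 2
        · rw [hz _ ht]
          exact Nat.zero_le _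
        · rw [Function.update_of_ne (by omega), Function.update_of_ne (by omega)]
          exact hh.2.2.2 (t + 1) (by omega)
    refine ⟨⟨hO, ?_⟩, hO.socleDeg_eq ?_ (hz _ le_rfl)⟩
    · rw [mult_eq_sum_range hz]
      have hsum := hh.mult_eq_sum_socleDeg
      rw [hs] at h₁ hsum
      rw [Finset.sum_range_succ, h₁] at hsum
      rw [Finset.sum_update_of_notMem (by simp)]
      omega
    · rw [Function.update_of_ne (by omega)]
      exact hh.ne_zero_of_le_socleDeg (by omega)
  have happend : ∀ g ∈ oSeqs d,
      Function.update g (socleDeg g + 1) 1 ∈ {h ∈ oSeqs (d + 1) | h (socleDeg h) = 1} ∧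
        socleDeg (Function.update g (socleDeg g + 1) 1) = socleDeg g + 1 := by
    rintro g ⟨hg, hm⟩
    have hz : ∀ t, socleDeg g + 2 ≤ t → Function.update g (socleDeg g + 1) 1 t = 0 :=
      fun t ht => by
        rw [Function.update_of_ne (by omega), hg.eq_zero_of_socleDeg_lt (by omega)]
    have hO : IsFiniteOSeq (Function.update g (socleDeg g + 1) 1) := by
      refine .of_le_macaulay ?_ ⟨_, hz⟩ fun t => ?_
      · rw [Function.update_of_ne (by omega), hg.1]
      · rcases lt_trichotomy (t + 2) (socleDeg g + 1) with ht | ht | ht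
        · rw [Function.update_of_ne (by omega), Function.update_of_ne (by omega)]
          exact hg.2.2.2 (t + 1) (by omega)
        · rw [ht, Function.update_self, Function.update_of_ne (by omega)]
          exact macaulay_pos (Nat.pos_of_ne_zero (hg.ne_zero_of_le_socleDeg (by omega)))
            (Nat.succ_pos t)
        · rw [hz _ (by omega)]
          exact Nat.zero_le _
    have hs : socleDeg (Function.update g (socleDeg g + 1) 1) = socleDeg g + 1 :=
      hO.socleDeg_eq (by simp) (hz _ le_rfl)
    refine ⟨⟨⟨hO, ?_⟩, by rw [hs, Function.update_self]⟩, hs⟩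
    rw [mult_eq_sum_range hz, Finset.sum_range_succ, Function.update_self,
      Finset.sum_update_of_notMem (by simp), ← hg.mult_eq_sum_socleDeg, hm]
  refine Set.BijOn.ncard_eq (f := fun h => Function.update h (socleDeg h) 0)
    (Set.InvOn.bijOn (f' := fun g => Function.update g (socleDeg g + 1) 1) ⟨?_, ?_⟩ ?_ ?_)
  · intro h hh
    obtain ⟨s, hs⟩ := hsucc h hh
    simp only [hs, (hdrop h hh s hs).2, Function.update_idem]
    have := hh.2
    rw [hs] at this
    exact (congrArg (Function.update h (s + 1)) this.symm).trans (Function.update_eq_self _ _)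
  · intro g hg
    simp only [(happend g hg).2, Function.update_idem]
    rw [← hg.1.eq_zero_of_socleDeg_lt (Nat.lt_succ_self (socleDeg g)),
      Nat.succ_eq_add_one, Function.update_eq_self]
  · intro h hh
    obtain ⟨s, hs⟩ := hsucc h hh
    simpa only [hs] using (hdrop h hh s hs).1
  · exact fun g hg => (happend g hg).1

lemma ncard_oSeqs_apply_one_lt_two {d : ℕ} (hd : 2 ≤ d) :
    {h ∈ oSeqs d | ¬ 2 ≤ h 1}.ncard = 1 := by
  rw [Set.ncard_eq_one]
  refine ⟨fun t => if t < d then 1 else 0, Set.eq_singleton_iff_unique_mem.mpr ⟨?_, ?_⟩⟩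
  · refine ⟨⟨.of_le_macaulay (if_pos (by omega)) ⟨d, fun t ht => if_neg (by omega)⟩
      fun t => ?_, ?_⟩, ?_⟩
    · by_cases ht : t + 2 < d
      · rw [if_pos ht, if_pos (by omega)]
        exact macaulay_pos one_pos (Nat.succ_pos t)
      · rw [if_neg ht]
        exact Nat.zero_le _
    · rw [mult_eq_sum_range (N := d) fun t ht => if_neg (by omega),
        Finset.sum_congr rfl fun t ht => if_pos (Finset.mem_range.mp ht)]
      simp
    · show ¬ 2 ≤ if 1 < d then 1 else 0
      rw [if_pos (by omega)]
      omega
  · rintro h ⟨⟨hh, hm⟩, h₁⟩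
    have hle : ∀ t, h t ≤ 1 := fun t => by
      simpa using hh.le_multichoose one_pos (by omega) t
    have hone : ∀ t ≤ socleDeg h, h t = 1 := fun t ht => by
      have := hh.ne_zero_of_le_socleDeg ht
      have := hle t
      omega
    have hs : d = socleDeg h + 1 := by
      rw [← hm, hh.mult_eq_sum_socleDeg, Finset.sum_congr rfl fun t ht =>
        hone t (by simp only [Finset.mem_range] at ht; omega)]
      simp
    funext t
    split_ifs with ht
    · exact hone t (by omega)
    · exact hh.eq_zero_of_socleDeg_lt (by omega)

lemma countAd_eq_one_add_ncard {d : ℕ} (hd : 2 < d) :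
    countAd d = 1 + {h ∈ oSeqs d | 2 ≤ h 1 ∧ Nat.multichoose (h 1 - 1) 2 < h 2}.ncard := by
  obtain ⟨d, rfl⟩ : ∃ e, d = e + 1 := ⟨d - 1, by omega⟩
  have hA : countAd (d + 1) = {h ∈ oSeqs (d + 1) | ¬ h (socleDeg h) = 1}.ncard := by
    rw [countAd]
    congr 1
    ext h
    constructor
    · rintro ⟨hh, hm, h₂⟩
      exact ⟨⟨hh, hm⟩, by omega⟩
    · rintro ⟨⟨hh, hm⟩, h₂⟩
      have := hh.ne_zero_of_le_socleDeg le_rfl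
      exact ⟨hh, hm, by omega⟩
  have e₁ := ncard_sep_add_ncard_sep_not (finite_oSeqs (d + 1)) fun h => h (socleDeg h) = 1
  have e₂ := ncard_sep_add_ncard_sep_not (finite_oSeqs (d + 1)) fun h => 2 ≤ h 1
  have e₃ := ncard_sep_add_ncard_sep_not
    ((finite_oSeqs (d + 1)).subset (Set.sep_subset _ fun h => 2 ≤ h 1))
    fun h => h 2 ≤ Nat.multichoose (h 1 - 1) 2
  rw [ncard_oSeqs_socle_eq_one (by omega)] at e₁
  rw [ncard_oSeqs_apply_one_lt_two (by omega)] at e₂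
  simp only [Set.mem_ofPred_eq, and_assoc, not_le] at e₃
  rw [ncard_oSeqs_of_le_multichoose (by omega)] at e₃
  omega

lemma lastReached_bounds {d : ℕ} {h : ℕ → ℕ} (hh : h ∈ oSeqs d) (h₁ : 2 ≤ h 1)
    (h₂ : Nat.multichoose (h 1 - 1) 2 < h 2) :
    h 1 + 1 ≤ d ∧ 1 ≤ lastReached (h 1) h ∧ lastReached (h 1) h ≤ lastReached (h 1 - 1) h ∧
      lastReached (h 1 - 1) h + 2 ≤ d ∧ 2 ≤ mult (upperPart (h 1 - 1) h) ∧
      mult (upperPart (h 1 - 1) h) + 2 ≤ d := by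
  obtain ⟨hh, rfl⟩ := hh
  obtain ⟨q, hq⟩ : ∃ q, h 1 = q + 2 := ⟨h 1 - 2, by omega⟩
  have hl := isFiniteOSeq_lowerPart hh q.add_one_pos
  have hu := isFiniteOSeq_upperPart hh q.add_one_pos hq
  have hmul := mult_lowerPart_add_mult_upperPart hh q.add_one_pos hq
  have hq' : h 1 - 1 = q + 1 := by omega
  rw [hq'] at h₂ ⊢
  rw [hq]
  have hK : ReachesUpTo (q + 2) _ h := (hh.reachesUpTo_iff (by omega)).mpr rfl
  have hI : ReachesUpTo (q + 1) _ h := (hh.reachesUpTo_iff (by omega)).mpr rfl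
  have hmu : 2 ≤ mult (upperPart (q + 1) h) := by
    have := hu.one_add_le_mult
    simp only [upperPart, Nat.reduceAdd] at this
    omega
  have hml : 2 ≤ mult (lowerPart (q + 1) h) := by
    have := hl.one_add_le_mult
    simp only [lowerPart, hq, Nat.multichoose_one_right] at this
    omega
  have hlt : lastReached (q + 1) h < mult (lowerPart (q + 1) h) := hl.lt_mult <| by
    rw [hI.agreesUpTo_lowerPart.1 _ le_rfl]
    exact (multichoose_pos q.add_one_pos _).ne'
  have h1le := hh.one_add_le_mult
  refine ⟨by omega, ?_, ?_, by omega, hmu, by omega⟩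
  · rw [hK 1, Nat.multichoose_one_right, hq]
  · rw [hI]
    exact (multichoose_mono_left (Nat.le_succ _) _).trans ((hK _).mp le_rfl)

/-- For every integer `d > 2`,
`A_d = 1 + Σ_{ℓ=1}^{d−2} Σ_{k=1}^{d−2} Σ_{i=k}^{d−2} Σ_{j=2}^{d−2}
O(d−ℓ−1, d−1, i, d−j) · O(d−ℓ, i−1, k−1, j)`. -/
theorem stmt10 (d : ℕ) (hd : 2 < d) :
    countAd d =
      1 + ∑ ℓ ∈ Finset.Icc (1 : ℤ) ((d : ℤ) - 2), ∑ k ∈ Finset.Icc (1 : ℤ) ((d : ℤ) - 2),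
          ∑ i ∈ Finset.Icc k ((d : ℤ) - 2), ∑ j ∈ Finset.Icc (2 : ℤ) ((d : ℤ) - 2),
            countO ((d : ℤ) - ℓ - 1) ((d : ℤ) - 1) i ((d : ℤ) - j) *
              countO ((d : ℤ) - ℓ) (i - 1) (k - 1) j := by
  rw [countAd_eq_one_add_ncard hd]
  congr 1
  set G := {h ∈ oSeqs d | 2 ≤ h 1 ∧ Nat.multichoose (h 1 - 1) 2 < h 2} with hG
  have hfin : G.Finite := (finite_oSeqs d).subset (Set.sep_subset _ _)
  have hbd : ∀ h ∈ G, _ := fun h hh => lastReached_bounds hh.1 hh.2.1 hh.2.2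
  rw [Set.ncard_eq_toFinset_card G hfin,
    Finset.card_eq_sum_card_fiberwise (f := fun h => (d : ℤ) - h 1)
      (t := Finset.Icc (1 : ℤ) ((d : ℤ) - 2)) fun h hh => ?_]
  swap
  · have hh' : h ∈ G := by simpa using hh
    have := hbd h hh'
    have := hh'.2.1
    simp only [Finset.coe_Icc, Set.mem_Icc]
    omega
  refine Finset.sum_congr rfl fun ℓ hℓ => ?_
  rw [Finset.card_eq_sum_card_fiberwise (f := fun h => (lastReached (h 1) h : ℤ))
      (t := Finset.Icc (1 : ℤ) ((d : ℤ) - 2)) fun h hh => ?_]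
  swap
  · simp only [Finset.coe_filter, Set.Finite.mem_toFinset, Set.mem_ofPred_eq] at hh
    have := hbd h hh.1
    simp only [Finset.coe_Icc, Set.mem_Icc]
    omega
  refine Finset.sum_congr rfl fun k hk => ?_
  rw [Finset.card_eq_sum_card_fiberwise (f := fun h => (lastReached (h 1 - 1) h : ℤ))
      (t := Finset.Icc k ((d : ℤ) - 2)) fun h hh => ?_]
  swap
  · simp only [Finset.coe_filter, Finset.mem_filter, Set.Finite.mem_toFinset,
      Set.mem_ofPred_eq] at hh
    have := hbd h hh.1.1
    have := hh.2
    simp only [Finset.coe_Icc, Set.mem_Icc]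
    omega
  refine Finset.sum_congr rfl fun i hi => ?_
  rw [Finset.card_eq_sum_card_fiberwise (f := fun h => (mult (upperPart (h 1 - 1) h) : ℤ))
      (t := Finset.Icc (2 : ℤ) ((d : ℤ) - 2)) fun h hh => ?_]
  swap
  · simp only [Finset.coe_filter, Finset.mem_filter, Set.Finite.mem_toFinset,
      Set.mem_ofPred_eq] at hh
    have := hbd h hh.1.1.1
    simp only [Finset.coe_Icc, Set.mem_Icc]
    omega
  refine Finset.sum_congr rfl fun j hj => ?_
  simp only [Finset.mem_Icc] at hℓ hk hi hj
  obtain ⟨q, hq⟩ : ∃ q : ℕ, (d : ℤ) - ℓ = q + 2 := ⟨((d : ℤ) - ℓ - 2).toNat, by omega⟩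
  obtain ⟨k, rfl⟩ : ∃ m : ℕ, k = m + 1 := ⟨(k - 1).toNat, by omega⟩
  lift i to ℕ using by omega
  lift j to ℕ using by omega
  rw [show (d : ℤ) - ℓ - 1 = q + 1 by omega, hq, add_sub_cancel_right,
    ← ncard_split_eq_countO_mul_countO (by omega) (by omega) (by omega),
    ← Set.ncard_coe_finset]
  congr 1
  ext h
  simp only [Finset.coe_filter, Finset.mem_filter, Set.Finite.mem_toFinset, Set.mem_ofPred_eq,
    hG, Nat.cast_inj]
  constructor
  · rintro ⟨⟨⟨⟨⟨hh, -, -⟩, h₁⟩, hK⟩, hI⟩, hJ⟩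
    have hq' : h 1 = q + 2 := by omega
    rw [hq', show q + 2 - 1 = q + 1 by omega] at hI hJ
    rw [hq'] at hK
    exact ⟨hh, hq', (hh.1.reachesUpTo_iff (by omega)).mpr (by omega),
      (hh.1.reachesUpTo_iff (by omega)).mpr hI, hJ⟩
  · rintro ⟨hh, hq', hK, hI, hJ⟩
    have h₂ : Nat.multichoose (q + 1) 2 < h 2 := by
      by_contra hle
      have := (isFiniteOSeq_upperPart hh.1 q.add_one_pos hq').mult_eq_one
        (Nat.sub_eq_zero_of_le (not_lt.mp hle))
      omega
    rw [hh.1.reachesUpTo_iff (by omega)] at hK hI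
    rw [hq', show q + 2 - 1 = q + 1 by omega]
    exact ⟨⟨⟨⟨⟨hh, by omega, h₂⟩, by omega⟩, by omega⟩, hI⟩, hJ⟩
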